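/- arXiv:1601.03596 — 4 statements merged into one kernel-verified Lean document; each statement's English description precedes it below -/
import Mathlib

section
/- Let Γ1 and Γ2 be invariant local bigness notions for a complete first-order theory T, regarded also as global bigness notions by declaring a complete type Γℓ-big iff the conjunction of each of its finite subsets is Γℓ-big. Then the following are equivalent: (a) Γ1 and Γ2 are orthogonal; (b) for every model M of T, every set A with A_{Γ1} ∪ A_{Γ2} ⊆ A ⊆ M, and all tuples ā¹, ā² in M such that p1 = tp(ā¹, A, M) is Γ1-big and p2 = tp(ā², A, M) is Γ2-big, the following set of formulas in the disjoint variable tuples x̄¹, x̄² is consistent with the elementary diagram of M: p1(x̄¹) ∪ p2(x̄²) ∪ {¬φ(x̄¹, x̄², b̄) : b̄ ⊆ A and φ(x̄¹, ā², b̄) is Γ1-small in M} ∪ {¬φ(x̄¹, x̄², b̄) : b̄ ⊆ A and φ(ā¹, x̄², b̄) is Γ2-small in M}. -/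
namespace Shelah482

open FirstOrder Language Cardinal

universe u

variable {L : FirstOrder.Language.{u, u}} {T : L.Theory} {γ : Type u}

/-- The conjunction of a finite list of formulas. -/
def listConj {α : Type u} : List (L.Formula α) → L.Formula α
  | [] => ⊤
  | φ :: l => φ ⊓ listConj l

/-- A *local bigness notion* `Γ` for a theory `T` (here the parameter set `A_Γ` of `Γ`
is absorbed into the language as constant symbols, so that all models of the complete
theory `T` elementarily extend `M_Γ` after naming these parameters): for every model
`M` of `T` it declares certain formulas `φ(x̄_Γ, ā)` with parameters `ā` from `M` to be
*`Γ`-big* (the remaining ones being *`Γ`-small*), in such a way that the `Γ`-small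
formulas form a proper ideal which is preserved by all automorphisms of `M` (such
automorphisms automatically fix the parameters `A_Γ`, being constants, pointwise). -/
structure LocalBigness (L : FirstOrder.Language.{u, u}) (T : L.Theory) (γ : Type u) :
    Type (u + 1) where
  Big : ∀ M : Theory.ModelType.{u, u, u} T, L.Formula (γ ⊕ M) → Prop
  aut_invariant : ∀ (M : Theory.ModelType.{u, u, u} T) (g : M ≃[L] M)
      (φ : L.Formula (γ ⊕ M)), Big M (φ.relabel (Sum.map id ⇑g)) ↔ Big M φ
  mono : ∀ (M : Theory.ModelType.{u, u, u} T) (φ ψ : L.Formula (γ ⊕ M)),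
      (∀ x : γ → M, φ.Realize (Sum.elim x id) → ψ.Realize (Sum.elim x id)) →
      Big M φ → Big M ψ
  small_sup : ∀ (M : Theory.ModelType.{u, u, u} T) (φ ψ : L.Formula (γ ⊕ M)),
      ¬ Big M φ → ¬ Big M ψ → ¬ Big M (φ ⊔ ψ)
  small_bot : ∀ M : Theory.ModelType.{u, u, u} T, ¬ Big M (⊥ : L.Formula (γ ⊕ M))
  exists_big : ∀ M : Theory.ModelType.{u, u, u} T, ∃ φ, Big M φ

/-- The complete type of the tuple `a` over the parameter set `A` in `M`. -/
def typeOf (M : Theory.ModelType.{u, u, u} T) (A : Set M) (a : γ → M) :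
    Set (L.Formula (γ ⊕ ↥A)) :=
  { φ | φ.Realize (Sum.elim a Subtype.val) }

/-- A (partial) type `p` over `A ⊆ M` is `Γ`-big in `M` if the conjunction of every
finite subset of `p` is a `Γ`-big formula in `M`. -/
def LocalBigness.BigType (Γ : LocalBigness L T γ) (M : Theory.ModelType.{u, u, u} T)
    (A : Set M) (p : Set (L.Formula (γ ⊕ ↥A))) : Prop :=
  ∀ l : List (L.Formula (γ ⊕ ↥A)), (∀ φ ∈ l, φ ∈ p) →
    Γ.Big M ((listConj l).relabel (Sum.map id Subtype.val))

/-- A local bigness notion is *invariant* if whether `φ(x̄_Γ, ā)` is `Γ`-big in a model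
depends only on `φ(x̄, ȳ)` and on the complete first-order type of `ā` over `A_Γ`
(the parameters `A_Γ` being constants of the language). -/
def LocalBigness.Invariant (Γ : LocalBigness L T γ) : Prop :=
  ∀ (M N : Theory.ModelType.{u, u, u} T) (n : ℕ) (φ : L.Formula (γ ⊕ Fin n))
    (a : Fin n → M) (b : Fin n → N),
    (∀ ψ : L.Formula (Fin n), ψ.Realize a ↔ ψ.Realize b) →
    (Γ.Big M (φ.relabel (Sum.map id a)) ↔ Γ.Big N (φ.relabel (Sum.map id b)))

/-- `b` realizes, over the image of `A` under the elementary embedding `emb : M → N`,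
the type that `a` realizes over `A` in `M`. -/
def RealizesTypeOf {M N : Theory.ModelType.{u, u, u} T} (emb : M ↪ₑ[L] N)
    (A : Set M) (a : γ → M) (b : γ → N) : Prop :=
  ∀ φ : L.Formula (γ ⊕ ↥A),
    φ.Realize (Sum.elim a Subtype.val) ↔ φ.Realize (Sum.elim b fun x => emb x.val)

/-- Orthogonality of two (global) bigness notions, given by their bigness predicates
on types: whenever `tp(āˡ, A, M)` is `Γℓ`-big for `ℓ = 1,2`, there are an elementary
extension `N` of `M` and tuples `b̄ˡ` in `N` realizing `tp(āˡ, A, M)` such that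
`tp(b̄ˡ, A ∪ b̄^(3−ℓ), N)` is `Γℓ`-big. -/
def Orthogonal {γ₁ γ₂ : Type u}
    (B₁ : ∀ (M : Theory.ModelType.{u, u, u} T) (A : Set M),
      Set (L.Formula (γ₁ ⊕ ↥A)) → Prop)
    (B₂ : ∀ (M : Theory.ModelType.{u, u, u} T) (A : Set M),
      Set (L.Formula (γ₂ ⊕ ↥A)) → Prop) : Prop :=
  ∀ (M : Theory.ModelType.{u, u, u} T) (A : Set M) (a₁ : γ₁ → M) (a₂ : γ₂ → M),
    B₁ M A (typeOf M A a₁) → B₂ M A (typeOf M A a₂) →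
    ∃ (N : Theory.ModelType.{u, u, u} T) (emb : M ↪ₑ[L] N) (b₁ : γ₁ → N) (b₂ : γ₂ → N),
      RealizesTypeOf emb A a₁ b₁ ∧ RealizesTypeOf emb A a₂ b₂ ∧
      B₁ N (⇑emb '' A ∪ Set.range b₂) (typeOf N (⇑emb '' A ∪ Set.range b₂) b₁) ∧
      B₂ N (⇑emb '' A ∪ Set.range b₁) (typeOf N (⇑emb '' A ∪ Set.range b₁) b₂)

variable {γ₁ γ₂ : Type u}

/-- Substituting the tuple `ā²` for the variables `x̄²` in a formula `φ(x̄¹, x̄², b̄)`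
with parameters in `A ⊆ M`, yielding a formula in the variables `x̄¹` with parameters
in `M`. -/
def substRight {M : Theory.ModelType.{u, u, u} T} {A : Set M}
    (a₂ : γ₂ → M) (φ : L.Formula ((γ₁ ⊕ γ₂) ⊕ ↥A)) : L.Formula (γ₁ ⊕ M) :=
  φ.relabel
    (Sum.elim (Sum.elim Sum.inl fun y => Sum.inr (a₂ y)) fun x => Sum.inr x.val)

/-- Substituting the tuple `ā¹` for the variables `x̄¹` in a formula `φ(x̄¹, x̄², b̄)`
with parameters in `A ⊆ M`, yielding a formula in the variables `x̄²` with parameters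
in `M`. -/
def substLeft {M : Theory.ModelType.{u, u, u} T} {A : Set M}
    (a₁ : γ₁ → M) (φ : L.Formula ((γ₁ ⊕ γ₂) ⊕ ↥A)) : L.Formula (γ₂ ⊕ M) :=
  φ.relabel
    (Sum.elim (Sum.elim (fun x => Sum.inr (a₁ x)) Sum.inl) fun x => Sum.inr x.val)

/-- The set of formulas from clause (b) of Statement 1:
`p₁(x̄¹) ∪ p₂(x̄²) ∪ {¬φ(x̄¹, x̄², b̄) : φ(x̄¹, ā², b̄) is Γ₁-small}
∪ {¬φ(x̄¹, x̄², b̄) : φ(ā¹, x̄², b̄) is Γ₂-small}`. -/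
def orthWitnessSet (Γ₁ : LocalBigness L T γ₁) (Γ₂ : LocalBigness L T γ₂)
    (M : Theory.ModelType.{u, u, u} T) (A : Set M) (a₁ : γ₁ → M) (a₂ : γ₂ → M) :
    Set (L.Formula ((γ₁ ⊕ γ₂) ⊕ ↥A)) :=
  (fun φ : L.Formula (γ₁ ⊕ ↥A) => φ.relabel (Sum.map Sum.inl id)) '' typeOf M A a₁ ∪
  (fun φ : L.Formula (γ₂ ⊕ ↥A) => φ.relabel (Sum.map Sum.inr id)) '' typeOf M A a₂ ∪
  { ψ | ∃ φ : L.Formula ((γ₁ ⊕ γ₂) ⊕ ↥A),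
      ψ = φ.not ∧ ¬ Γ₁.Big M (substRight a₂ φ) } ∪
  { ψ | ∃ φ : L.Formula ((γ₁ ⊕ γ₂) ⊕ ↥A),
      ψ = φ.not ∧ ¬ Γ₂.Big M (substLeft a₁ φ) }

/-- A set of formulas in the variables `x̄¹, x̄²` with parameters in `A ⊆ M` is
finitely satisfiable in `M` (equivalently, consistent with the elementary diagram
of `M`). -/
def FinSatIn (M : Theory.ModelType.{u, u, u} T) (A : Set M)
    (S : Set (L.Formula ((γ₁ ⊕ γ₂) ⊕ ↥A))) : Prop :=
  ∀ l : List (L.Formula ((γ₁ ⊕ γ₂) ⊕ ↥A)), (∀ φ ∈ l, φ ∈ S) →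
    ∃ v : γ₁ ⊕ γ₂ → M, ∀ φ ∈ l, Formula.Realize φ (Sum.elim v Subtype.val)

/-- Every formula is equivalent to one mentioning only finitely many of the right-hand
variables. -/
theorem exists_relabel_fin {α β : Type u} (φ : L.Formula (α ⊕ β)) :
    ∃ (n : ℕ) (e : Fin n → β) (ψ : L.Formula (α ⊕ Fin n)), Function.Injective e ∧
      ∀ (M : Type u) [L.Structure M] (v : α → M) (w : β → M),
        ψ.Realize (Sum.elim v (w ∘ e)) ↔ φ.Realize (Sum.elim v w) := by
  classical
  let s : Set β := Sum.inr ⁻¹' (φ.freeVarFinset : Set (α ⊕ β))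
  have hs : s.Finite := φ.freeVarFinset.finite_toSet.preimage Sum.inr_injective.injOn
  have : Finite s := hs
  obtain ⟨n, ⟨e⟩⟩ := Finite.exists_equiv_fin s
  let f : φ.freeVarFinset → α ⊕ Fin n := fun x =>
    match x with
    | ⟨Sum.inl a, _⟩ => Sum.inl a
    | ⟨Sum.inr b, hb⟩ => Sum.inr (e ⟨b, hb⟩)
  refine ⟨n, fun i => (e.symm i).1, φ.restrictFreeVar f,
    Subtype.val_injective.comp e.symm.injective, fun M _ v w => ?_⟩
  refine BoundedFormula.realize_restrictFreeVar (Sum.elim v w) ?_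
  rintro ⟨a | b, h⟩ <;> simp [f]

/-- A formula with parameters in `M` that is satisfiable in an elementary extension of `M`
is satisfiable in `M`. -/
theorem exists_realize_of_embedding {M N : Type u} [L.Structure M] [L.Structure N] [Nonempty M]
    (emb : M ↪ₑ[L] N) {α β : Type u} (φ : L.Formula (α ⊕ β)) (c : β → M) (v : α → N)
    (h : φ.Realize (Sum.elim v (emb ∘ c))) : ∃ v : α → M, φ.Realize (Sum.elim v c) := by
  obtain ⟨n, e, ψ, he, hψ⟩ := exists_relabel_fin (φ.relabel (Sum.swap : α ⊕ β → β ⊕ α))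
  have key : ∀ (K : Type u) [L.Structure K] (x : α → K) (y : β → K),
      ψ.Realize (Sum.elim y (x ∘ e)) ↔ φ.Realize (Sum.elim x y) := by
    intro K _ x y
    rw [hψ, Formula.realize_relabel]
    congr! 1
    ext (i | i) <;> rfl
  have hN : (ψ.iExs (Fin n)).Realize (emb ∘ c) :=
    Formula.realize_iExs.2 ⟨v ∘ e, (key N v _).2 h⟩
  rw [emb.map_formula, Formula.realize_iExs] at hN
  obtain ⟨w, hw⟩ := hN
  refine ⟨Function.extend e w fun _ => Classical.arbitrary M, (key M _ _).1 ?_⟩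
  convert hw
  ext i
  exact he.extend_apply _ _ _

theorem realize_listConj {M : Type u} [L.Structure M] {α : Type u} (l : List (L.Formula α))
    (v : α → M) : (listConj l).Realize v ↔ ∀ φ ∈ l, φ.Realize v := by
  induction l with
  | nil => simp [listConj]
  | cons φ l ih => simp [listConj, ih]

/-- A set of formulas with parameters in `M` which is finitely satisfiable in `M` is
realized in an elementary extension of `M`. -/
theorem exists_embedding_realize (M : Theory.ModelType.{u, u, u} T) {α : Type u} {A : Set M}
    (S : Set (L.Formula (α ⊕ ↥A)))
    (hS : ∀ l : List (L.Formula (α ⊕ ↥A)), (∀ φ ∈ l, φ ∈ S) →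
      ∃ v : α → M, ∀ φ ∈ l, Formula.Realize φ (Sum.elim v Subtype.val)) :
    ∃ (N : Theory.ModelType.{u, u, u} T) (emb : M ↪ₑ[L] N) (v : α → N),
      ∀ φ ∈ S, Formula.Realize φ (Sum.elim v fun x => emb x.val) := by
  classical
  have hF : ∀ s : Finset S, ∃ v : α → M, ∀ φ ∈ s,
      Formula.Realize φ.1 (Sum.elim v Subtype.val) := by
    intro s
    obtain ⟨v, hv⟩ := hS (s.toList.map Subtype.val) (by simp +contextual)
    exact ⟨v, fun φ hφ => hv _ (List.mem_map_of_mem (Finset.mem_toList.2 hφ))⟩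
  choose w hw using hF
  let U : Ultrafilter (Finset S) := Ultrafilter.of Filter.atTop
  let N := (U : Filter (Finset S)).Product fun _ => (M : Type u)
  let emb : M ↪ₑ[L] N :=
    { toFun := fun m => ((fun _ => m : Finset S → M) : N)
      map_formula' := fun n φ x => by
        have := Ultraproduct.realize_formula_cast (u := U) (M := fun _ => (M : Type u)) φ
          fun i _ => x i
        exact this.trans Filter.eventually_const }
  have : N ⊨ T := (emb.theory_model_iff T).1 inferInstance
  refine ⟨Theory.ModelType.of T N, emb, fun i => ((fun s => w s i : Finset S → M) : N),
    fun φ hφ => ?_⟩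
  have key := Ultraproduct.realize_formula_cast (u := U) (M := fun _ => (M : Type u)) φ
    fun i s => Sum.elim (w s) Subtype.val i
  have hev : ∀ᶠ s in (U : Filter (Finset S)), φ.Realize (Sum.elim (w s) Subtype.val) := by
    refine Ultrafilter.of_le _ ?_
    filter_upwards [Filter.eventually_ge_atTop ({⟨φ, hφ⟩} : Finset S)] with s hs
    exact hw s ⟨φ, hφ⟩ (hs (Finset.mem_singleton_self _))
  have hval : (Sum.elim (fun i => ((fun s => w s i : Finset S → M) : N))
      fun x : ↥A => emb x.val) =
      fun i => ((fun s => Sum.elim (w s) Subtype.val i : Finset S → M) : N) := by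
    funext i
    cases i <;> rfl
  exact (congrArg (Formula.Realize φ) hval).mpr (key.2 hev)

namespace LocalBigness

theorem big_congr (Γ : LocalBigness L T γ) {M : Theory.ModelType.{u, u, u} T}
    {φ ψ : L.Formula (γ ⊕ M)}
    (h : ∀ x : γ → M, φ.Realize (Sum.elim x id) ↔ ψ.Realize (Sum.elim x id)) :
    Γ.Big M φ ↔ Γ.Big M ψ :=
  ⟨Γ.mono M φ ψ fun x => (h x).1, Γ.mono M ψ φ fun x => (h x).2⟩

/-- Invariance for parameter tuples indexed by an arbitrary type. -/
theorem Invariant.big_relabel_iff {Γ : LocalBigness L T γ} (hΓ : Γ.Invariant)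
    {M N : Theory.ModelType.{u, u, u} T} {β : Type u} (φ : L.Formula (γ ⊕ β))
    {a : β → M} {b : β → N} (hab : ∀ ψ : L.Formula β, ψ.Realize a ↔ ψ.Realize b) :
    Γ.Big M (φ.relabel (Sum.map id a)) ↔ Γ.Big N (φ.relabel (Sum.map id b)) := by
  obtain ⟨n, e, ψ, -, hψ⟩ := exists_relabel_fin φ
  have key : ∀ (K : Theory.ModelType.{u, u, u} T) (c : β → K),
      Γ.Big K (φ.relabel (Sum.map id c)) ↔ Γ.Big K (ψ.relabel (Sum.map id (c ∘ e))) := by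
    intro K c
    refine Γ.big_congr fun x => ?_
    simpa [Formula.realize_relabel, Function.comp_def, Sum.elim_map] using! (hψ K x c).symm
  rw [key, key]
  refine hΓ M N n ψ _ _ fun θ => ?_
  simpa [Formula.realize_relabel] using hab (θ.relabel e)

/-- A complete type is big if and only if each of its formulas is big. -/
theorem bigType_typeOf_iff (Γ : LocalBigness L T γ) {M : Theory.ModelType.{u, u, u} T}
    {A : Set M} {a : γ → M} :
    Γ.BigType M A (typeOf M A a) ↔
      ∀ φ ∈ typeOf M A a, Γ.Big M (φ.relabel (Sum.map id Subtype.val)) := by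
  constructor
  · intro h φ hφ
    refine (Γ.big_congr fun x => ?_).1 (h [φ] (by simpa using hφ))
    simp [Formula.realize_relabel, listConj]
  · exact fun h l hl => h _ ((realize_listConj l _).2 hl)

theorem big_relabel_relabel_iff (Γ : LocalBigness L T γ) {M : Theory.ModelType.{u, u, u} T}
    {α β : Type u} (φ : L.Formula α) (f : α → β) (g : β → γ ⊕ M) :
    Γ.Big M ((φ.relabel f).relabel g) ↔ Γ.Big M (φ.relabel (g ∘ f)) :=
  Γ.big_congr fun x => by simp only [Formula.realize_relabel, Function.comp_assoc]

/-- Bigness of `tp(c, A ∪ b, N)`, expressed through a tuple `a` of `M` with the same type over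
`A` as `b`. -/
theorem Invariant.bigType_union_range_iff {Γ : LocalBigness L T γ} (hΓ : Γ.Invariant)
    {δ α : Type u} {M N : Theory.ModelType.{u, u, u} T} {emb : M ↪ₑ[L] N} {A : Set M}
    {a : δ → M} {b : δ → N} (hab : RealizesTypeOf emb A a b) (c : γ → N)
    (σ : α ≃ γ ⊕ (δ ⊕ ↥A)) :
    Γ.BigType N (⇑emb '' A ∪ Set.range b) (typeOf N (⇑emb '' A ∪ Set.range b) c) ↔
      ∀ φ : L.Formula α,
        φ.Realize (Sum.elim c (Sum.elim b fun x => emb x.val) ∘ σ) →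
        Γ.Big M (φ.relabel (Sum.map id (Sum.elim a Subtype.val) ∘ σ)) := by
  rw [bigType_typeOf_iff]
  let r : δ ⊕ ↥A → ↥(⇑emb '' A ∪ Set.range b) :=
    Sum.elim (fun i => ⟨b i, Or.inr ⟨i, rfl⟩⟩) fun x => ⟨emb x.val, Or.inl ⟨x.val, x.2, rfl⟩⟩
  have hr : Subtype.val ∘ r = Sum.elim b fun x => emb x.val := by
    funext i
    cases i <;> rfl
  have hsurj : Function.Surjective r := by
    rintro ⟨_, ⟨x, hx, rfl⟩ | ⟨i, rfl⟩⟩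
    · exact ⟨Sum.inr ⟨x, hx⟩, rfl⟩
    · exact ⟨Sum.inl i, rfl⟩
  constructor
  · intro h φ hφ
    rw [← big_relabel_relabel_iff, hΓ.big_relabel_iff (φ.relabel σ) hab, ← hr]
    have := h ((φ.relabel σ).relabel (Sum.map id r)) (by
      simpa [typeOf, Formula.realize_relabel, Sum.elim_comp_map, hr] using hφ)
    rwa [big_relabel_relabel_iff, Sum.map_comp_map] at this
  · intro h φ hφ
    obtain ⟨s, hs⟩ := hsurj.hasRightInverse
    have hs' : (Sum.elim b fun x => emb x.val) ∘ s = Subtype.val := by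
      rw [← hr, Function.comp_assoc, hs.comp_eq_id, Function.comp_id]
    change φ.Realize _ at hφ
    have := h ((φ.relabel (Sum.map id s)).relabel σ.symm) (by
      simpa [Formula.realize_relabel, Function.comp_assoc, Sum.elim_comp_map, hs'] using hφ)
    rwa [big_relabel_relabel_iff, Function.comp_assoc, σ.self_comp_symm, Function.comp_id,
      hΓ.big_relabel_iff _ hab, big_relabel_relabel_iff, Sum.map_comp_map, hs'] at this

end LocalBigness

theorem realizesTypeOf_of_imp {M N : Theory.ModelType.{u, u, u} T} {emb : M ↪ₑ[L] N} {A : Set M}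
    {a : γ → M} {b : γ → N}
    (h : ∀ φ ∈ typeOf M A a, Formula.Realize φ (Sum.elim b fun x => emb x.val)) :
    RealizesTypeOf emb A a b := fun φ =>
  ⟨h φ, fun hb => by
    by_contra ha
    exact h φ.not ha hb⟩

/-- Reordering `(x̄¹, x̄²), b̄` as `x̄², (x̄¹, b̄)`. -/
def sumCommAssoc (α β δ : Type u) : (α ⊕ β) ⊕ δ ≃ β ⊕ (α ⊕ δ) :=
  ((Equiv.sumComm α β).sumCongr (Equiv.refl δ)).trans (Equiv.sumAssoc β α δ)

/-- Tuples in an elementary extension realize `orthWitnessSet` exactly when they witness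
orthogonality. -/
theorem realize_orthWitnessSet_iff {Γ₁ : LocalBigness L T γ₁} {Γ₂ : LocalBigness L T γ₂}
    (hInv₁ : Γ₁.Invariant) (hInv₂ : Γ₂.Invariant) {M N : Theory.ModelType.{u, u, u} T}
    (emb : M ↪ₑ[L] N) (A : Set M) (a₁ : γ₁ → M) (a₂ : γ₂ → M) (b₁ : γ₁ → N) (b₂ : γ₂ → N) :
    (∀ φ ∈ orthWitnessSet Γ₁ Γ₂ M A a₁ a₂,
      Formula.Realize φ (Sum.elim (Sum.elim b₁ b₂) fun x => emb x.val)) ↔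
      RealizesTypeOf emb A a₁ b₁ ∧ RealizesTypeOf emb A a₂ b₂ ∧
      Γ₁.BigType N (⇑emb '' A ∪ Set.range b₂) (typeOf N (⇑emb '' A ∪ Set.range b₂) b₁) ∧
      Γ₂.BigType N (⇑emb '' A ∪ Set.range b₁) (typeOf N (⇑emb '' A ∪ Set.range b₁) b₂) := by
  have hvar₁ : Sum.elim b₁ (Sum.elim b₂ fun x : ↥A => emb x.val) ∘ Equiv.sumAssoc γ₁ γ₂ ↥A =
      Sum.elim (Sum.elim b₁ b₂) fun x => emb x.val := by
    funext i
    rcases i with (i | i) | i <;> rfl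
  have hvar₂ : Sum.elim b₂ (Sum.elim b₁ fun x : ↥A => emb x.val) ∘ sumCommAssoc γ₁ γ₂ ↥A =
      Sum.elim (Sum.elim b₁ b₂) fun x => emb x.val := by
    funext i
    rcases i with (i | i) | i <;> rfl
  have hsub₁ : ∀ φ : L.Formula ((γ₁ ⊕ γ₂) ⊕ ↥A), substRight a₂ φ =
      φ.relabel (Sum.map id (Sum.elim a₂ Subtype.val) ∘ Equiv.sumAssoc γ₁ γ₂ ↥A) := by
    intro φ
    refine congrArg (fun f => Formula.relabel f φ) (funext fun i => ?_)
    rcases i with (i | i) | i <;> rfl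
  have hsub₂ : ∀ φ : L.Formula ((γ₁ ⊕ γ₂) ⊕ ↥A), substLeft a₁ φ =
      φ.relabel (Sum.map id (Sum.elim a₁ Subtype.val) ∘ sumCommAssoc γ₁ γ₂ ↥A) := by
    intro φ
    refine congrArg (fun f => Formula.relabel f φ) (funext fun i => ?_)
    rcases i with (i | i) | i <;> rfl
  have hinl : Sum.elim (Sum.elim b₁ b₂) (fun x : ↥A => emb x.val) ∘ Sum.map Sum.inl id =
      Sum.elim b₁ fun x => emb x.val := by
    funext i
    cases i <;> rfl
  have hinr : Sum.elim (Sum.elim b₁ b₂) (fun x : ↥A => emb x.val) ∘ Sum.map Sum.inr id =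
      Sum.elim b₂ fun x => emb x.val := by
    funext i
    cases i <;> rfl
  constructor
  · intro h
    have h₁ : RealizesTypeOf emb A a₁ b₁ := realizesTypeOf_of_imp fun φ hφ => by
      have := h _ (Or.inl (Or.inl (Or.inl ⟨φ, hφ, rfl⟩)))
      rwa [Formula.realize_relabel, hinl] at this
    have h₂ : RealizesTypeOf emb A a₂ b₂ := realizesTypeOf_of_imp fun φ hφ => by
      have := h _ (Or.inl (Or.inl (Or.inr ⟨φ, hφ, rfl⟩)))
      rwa [Formula.realize_relabel, hinr] at this
    refine ⟨h₁, h₂, (hInv₁.bigType_union_range_iff h₂ b₁ (Equiv.sumAssoc γ₁ γ₂ ↥A)).2 ?_,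
      (hInv₂.bigType_union_range_iff h₁ b₂ (sumCommAssoc γ₁ γ₂ ↥A)).2 ?_⟩
    · intro φ hφ
      rw [hvar₁] at hφ
      rw [← hsub₁]
      by_contra hsmall
      exact h _ (Or.inl (Or.inr ⟨φ, rfl, hsmall⟩)) hφ
    · intro φ hφ
      rw [hvar₂] at hφ
      rw [← hsub₂]
      by_contra hsmall
      exact h _ (Or.inr ⟨φ, rfl, hsmall⟩) hφ
  · rintro ⟨h₁, h₂, hbig₁, hbig₂⟩
    rw [hInv₁.bigType_union_range_iff h₂ b₁ (Equiv.sumAssoc γ₁ γ₂ ↥A), hvar₁] at hbig₁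
    rw [hInv₂.bigType_union_range_iff h₁ b₂ (sumCommAssoc γ₁ γ₂ ↥A), hvar₂] at hbig₂
    rintro _ (((⟨φ, hφ, rfl⟩ | ⟨φ, hφ, rfl⟩) | ⟨φ, rfl, hsmall⟩) | ⟨φ, rfl, hsmall⟩)
    · rw [Formula.realize_relabel, hinl]
      exact (h₁ φ).1 hφ
    · rw [Formula.realize_relabel, hinr]
      exact (h₂ φ).1 hφ
    · exact Formula.realize_not.2 fun hφ => hsmall (hsub₁ φ ▸ hbig₁ φ hφ)
    · exact Formula.realize_not.2 fun hφ => hsmall (hsub₂ φ ▸ hbig₂ φ hφ)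

/-!
Statement 1 (Observation 2.12(1)): for invariant local bigness notions `Γ₁, Γ₂`
(regarded as global bigness notions via `Γ.BigType`), orthogonality is equivalent to
the finite satisfiability, for all `M`, `A` and tuples `ā¹, ā²` with `tp(āˡ, A, M)`
`Γℓ`-big, of the set `orthWitnessSet`.
-/
theorem orthogonal_iff_finSat (hT : T.IsComplete)
    (Γ₁ : LocalBigness L T γ₁) (Γ₂ : LocalBigness L T γ₂)
    (hInv₁ : Γ₁.Invariant) (hInv₂ : Γ₂.Invariant) :
    Orthogonal Γ₁.BigType Γ₂.BigType ↔
      ∀ (M : Theory.ModelType.{u, u, u} T) (A : Set M) (a₁ : γ₁ → M) (a₂ : γ₂ → M),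
        Γ₁.BigType M A (typeOf M A a₁) → Γ₂.BigType M A (typeOf M A a₂) →
        FinSatIn M A (orthWitnessSet Γ₁ Γ₂ M A a₁ a₂) := by
  constructor
  · intro h M A a₁ a₂ hbig₁ hbig₂ l hl
    obtain ⟨N, emb, b₁, b₂, hb⟩ := h M A a₁ a₂ hbig₁ hbig₂
    have hreal := (realize_orthWitnessSet_iff hInv₁ hInv₂ emb A a₁ a₂ b₁ b₂).2 hb
    obtain ⟨v, hv⟩ := exists_realize_of_embedding emb (listConj l) Subtype.val (Sum.elim b₁ b₂)
      ((realize_listConj l _).2 fun φ hφ => hreal φ (hl φ hφ))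
    exact ⟨v, (realize_listConj l _).1 hv⟩
  · intro h M A a₁ a₂ hbig₁ hbig₂
    obtain ⟨N, emb, v, hv⟩ := exists_embedding_realize M _ (h M A a₁ a₂ hbig₁ hbig₂)
    refine ⟨N, emb, v ∘ Sum.inl, v ∘ Sum.inr,
      (realize_orthWitnessSet_iff hInv₁ hInv₂ emb A a₁ a₂ _ _).1 ?_⟩
    rwa [Sum.elim_comp_inl_inr]

end Shelah482
end

section
/- Let (A, ≤) be a partial order; call x, y ∈ A incompatible if there is no z ∈ A with x ≤ z and y ≤ z. For S ⊆ A and n ∈ ℕ, say that S carries an n-tree if there is a family (x_η), indexed by the binary sequences η of length at most n, of elements of S such that x_η < x_ν whenever η is a proper initial segment of ν, and x_{η⌢⟨0⟩} is incompatible with x_{η⌢⟨1⟩} for every η of length less than n. Then for all subsets S1, S2 ⊆ A: if S1 ∪ S2 carries an n-tree for every n ∈ ℕ, then S1 carries an n-tree for every n ∈ ℕ, or S2 carries an n-tree for every n ∈ ℕ. -/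
/-!
Statement 12 (ideal property underlying Claim 3.3(1) for `Γ^po`, with `R` taken as
incompatibility): in a partial order, if `S1 ∪ S2` carries an `n`-tree for every `n`,
then `S1` carries an `n`-tree for every `n`, or `S2` does.
-/

namespace Shelah482

/-- Two elements of a partial order are incompatible if they have no common upper
bound. -/
def Incompat {A : Type*} [PartialOrder A] (x y : A) : Prop :=
  ¬ ∃ z, x ≤ z ∧ y ≤ z

/-- `S` carries an `n`-tree: a family `(x_η)` of elements of `S` indexed by the binary
sequences `η` of length at most `n`, strictly increasing along proper initial segments,
with `x_{η⌢⟨0⟩}` incompatible with `x_{η⌢⟨1⟩}` for every `η` of length `< n`. -/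
def CarriesTree {A : Type*} [PartialOrder A] (S : Set A) (n : ℕ) : Prop :=
  ∃ x : ∀ l : List Bool, l.length ≤ n → A,
    (∀ l hl, x l hl ∈ S) ∧
    (∀ (l₁ : List Bool) (h₁ : l₁.length ≤ n) (l₂ : List Bool) (h₂ : l₂.length ≤ n),
      l₁ <+: l₂ → l₁ ≠ l₂ → x l₁ h₁ < x l₂ h₂) ∧
    (∀ (l : List Bool) (h : l.length < n),
      Incompat (x (l ++ [false]) (by simpa using h)) (x (l ++ [true]) (by simpa using h)))

/-- `r` is the root of a binary tree of height `n` in `S` in which siblings are incompatible. -/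
def IsTreeRoot {A : Type*} [PartialOrder A] (S : Set A) : ℕ → A → Prop
  | 0, r => r ∈ S
  | n + 1, r => r ∈ S ∧ ∃ y z, r < y ∧ r < z ∧ Incompat y z ∧ IsTreeRoot S n y ∧ IsTreeRoot S n z

theorem Incompat.mono {A : Type*} [PartialOrder A] {x y x' y' : A} (h : Incompat x y)
    (hx : x ≤ x') (hy : y ≤ y') : Incompat x' y' :=
  fun ⟨z, hxz, hyz⟩ => h ⟨z, hx.trans hxz, hy.trans hyz⟩

theorem IsTreeRoot.mem {A : Type*} [PartialOrder A] {S : Set A} {n : ℕ} {r : A}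
    (h : IsTreeRoot S n r) : r ∈ S := by
  cases n with
  | zero => exact h
  | succ n => exact h.1

theorem isTreeRoot_of_family {A : Type*} [PartialOrder A] {S : Set A} {n : ℕ}
    (x : ∀ l : List Bool, l.length ≤ n → A) (hS : ∀ l hl, x l hl ∈ S)
    (hlt : ∀ (l₁ : List Bool) (h₁ : l₁.length ≤ n) (l₂ : List Bool) (h₂ : l₂.length ≤ n),
      l₁ <+: l₂ → l₁ ≠ l₂ → x l₁ h₁ < x l₂ h₂)
    (hinc : ∀ (l : List Bool) (h : l.length < n),
      Incompat (x (l ++ [false]) (by simpa using h)) (x (l ++ [true]) (by simpa using h))) :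
    IsTreeRoot S n (x [] (Nat.zero_le n)) := by
  induction n with
  | zero => exact hS _ _
  | succ n ih =>
    have child (b : Bool) : IsTreeRoot S n (x [b] (by simp)) :=
      ih (fun l hl => x (b :: l) (by simpa using hl)) (fun _ _ => hS _ _)
        (fun l₁ h₁ l₂ h₂ hp hne =>
          hlt _ _ _ _ (List.cons_prefix_cons.2 ⟨rfl, hp⟩) (by simpa using hne))
        (fun l hl => hinc (b :: l) (by simpa using hl))
    exact ⟨hS _ _, _, _, hlt _ _ _ _ List.nil_prefix (by simp),
      hlt _ _ _ _ List.nil_prefix (by simp), hinc [] (by simp), child false, child true⟩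

theorem IsTreeRoot.exists_family {A : Type*} [PartialOrder A] {S : Set A} {n : ℕ} {r : A}
    (h : IsTreeRoot S n r) :
    ∃ x : List Bool → A, x [] = r ∧ (∀ l, l.length ≤ n → x l ∈ S) ∧
      (∀ l₁ l₂, l₂.length ≤ n → l₁ <+: l₂ → l₁ ≠ l₂ → x l₁ < x l₂) ∧
      (∀ l, l.length < n → Incompat (x (l ++ [false])) (x (l ++ [true]))) := by
  induction n generalizing r with
  | zero =>
    refine ⟨fun _ => r, rfl, fun _ _ => h, fun l₁ l₂ h₂ hp hne => ?_, by simp⟩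
    obtain rfl := List.length_eq_zero_iff.1 (Nat.le_zero.1 h₂)
    exact absurd (List.prefix_nil.1 hp) hne
  | succ n ih =>
    obtain ⟨hr, y, z, hy, hz, hyz, ty, tz⟩ := h
    have children (b : Bool) : ∃ x : List Bool → A, x [] = cond b z y ∧
        (∀ l, l.length ≤ n → x l ∈ S) ∧
        (∀ l₁ l₂, l₂.length ≤ n → l₁ <+: l₂ → l₁ ≠ l₂ → x l₁ < x l₂) ∧
        (∀ l, l.length < n → Incompat (x (l ++ [false])) (x (l ++ [true]))) := by
      cases b
      · exact ih ty
      · exact ih tz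
    choose f hroot hmem hlt hinc using children
    have root_lt (b : Bool) : r < f b [] := by
      rw [hroot]
      cases b <;> assumption
    refine ⟨fun | [] => r | b :: l => f b l, rfl, ?_, ?_, ?_⟩
    · rintro (_ | ⟨b, l⟩) hl
      · exact hr
      · exact hmem b l (by simpa using hl)
    · rintro (_ | ⟨b, l₁⟩) (_ | ⟨c, l₂⟩) h₂ hp hne
      · exact absurd rfl hne
      · rcases eq_or_ne l₂ [] with rfl | hl
        · exact root_lt c
        · exact (root_lt c).trans
            (hlt c [] l₂ (by simpa using h₂) List.nil_prefix hl.symm)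
      · simp at hp
      · obtain ⟨rfl, hp'⟩ := List.cons_prefix_cons.1 hp
        exact hlt b l₁ l₂ (by simpa using h₂) hp' (by simpa using hne)
    · rintro (_ | ⟨b, l⟩) hl
      · simpa [hroot] using hyz
      · exact hinc b l (by simpa using hl)

theorem carriesTree_iff_exists_isTreeRoot {A : Type*} [PartialOrder A] {S : Set A} {n : ℕ} :
    CarriesTree S n ↔ ∃ r, IsTreeRoot S n r := by
  constructor
  · rintro ⟨x, hS, hlt, hinc⟩
    exact ⟨_, isTreeRoot_of_family x hS hlt hinc⟩
  · rintro ⟨r, h⟩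
    obtain ⟨x, -, hS, hlt, hinc⟩ := h.exists_family
    exact ⟨fun l _ => x l, hS, fun l₁ _ l₂ h₂ => hlt l₁ l₂ h₂, hinc⟩

theorem IsTreeRoot.union {A : Type*} [PartialOrder A] {S T : Set A} {m k : ℕ} {r : A}
    (h : IsTreeRoot (S ∪ T) (m + k) r) :
    (∃ s, r ≤ s ∧ IsTreeRoot S m s) ∨ ∃ t, r ≤ t ∧ IsTreeRoot T k t := by
  induction hN : m + k generalizing m k r with
  | zero =>
    obtain ⟨rfl, rfl⟩ := Nat.add_eq_zero_iff.1 hN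
    exact h.mem.imp (fun hr => ⟨r, le_rfl, hr⟩) (fun hr => ⟨r, le_rfl, hr⟩)
  | succ N ih =>
    rw [hN] at h
    obtain ⟨hr, y, z, hy, hz, hyz, ty, tz⟩ := h
    rcases hr with hr | hr
    · rcases m with _ | m
      · exact .inl ⟨r, le_rfl, hr⟩
      have hN' : m + k = N := by omega
      rcases ih (hN' ▸ ty) hN' with ⟨s, hys, hs⟩ | ⟨t, hyt, ht⟩
      · rcases ih (hN' ▸ tz) hN' with ⟨s', hzs, hs'⟩ | ⟨t, hzt, ht⟩
        · exact .inl ⟨r, le_rfl, hr, s, s', hy.trans_le hys, hz.trans_le hzs,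
            hyz.mono hys hzs, hs, hs'⟩
        · exact .inr ⟨t, hz.le.trans hzt, ht⟩
      · exact .inr ⟨t, hy.le.trans hyt, ht⟩
    · rcases k with _ | k
      · exact .inr ⟨r, le_rfl, hr⟩
      have hN' : m + k = N := by omega
      rcases ih (hN' ▸ ty) hN' with ⟨s, hys, hs⟩ | ⟨t, hyt, ht⟩
      · exact .inl ⟨s, hy.le.trans hys, hs⟩
      · rcases ih (hN' ▸ tz) hN' with ⟨s, hzs, hs⟩ | ⟨t', hzt, ht'⟩
        · exact .inl ⟨s, hz.le.trans hzs, hs⟩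
        · exact .inr ⟨r, le_rfl, hr, t, t', hy.trans_le hyt, hz.trans_le hzt,
            hyz.mono hyt hzt, ht, ht'⟩

theorem carriesTree_union {A : Type*} [PartialOrder A] (S1 S2 : Set A)
    (h : ∀ n : ℕ, CarriesTree (S1 ∪ S2) n) :
    (∀ n : ℕ, CarriesTree S1 n) ∨ (∀ n : ℕ, CarriesTree S2 n) := by
  by_contra! hne
  obtain ⟨⟨m, hm⟩, k, hk⟩ := hne
  obtain ⟨r, hr⟩ := carriesTree_iff_exists_isTreeRoot.1 (h (m + k))
  rcases hr.union with ⟨s, -, hs⟩ | ⟨t, -, ht⟩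
  · exact hm (carriesTree_iff_exists_isTreeRoot.2 ⟨s, hs⟩)
  · exact hk (carriesTree_iff_exists_isTreeRoot.2 ⟨t, ht⟩)

end Shelah482
end

section
/- Let P and Q be sets and R ⊆ P × Q a relation. For S ⊆ Q and n ∈ ℕ, say that S is n-big for R if there is a finite set A ⊆ P such that for all pairwise distinct a_0, …, a_{2n−1} ∈ P ∖ A there exists c ∈ S with: for every ℓ < 2n, a_ℓ R c holds if and only if ℓ < n. Then for all S1, S2 ⊆ Q and all n, m ∈ ℕ: if S1 is not n-big for R and S2 is not m-big for R, then S1 ∪ S2 is not (n+m)-big for R. -/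
/-!
Statement 13 (ideal property of the independence bigness notion `Γ^ind`, Claim 3.7):
For a relation `R ⊆ P × Q`, say `S ⊆ Q` is `n`-big for `R` if there is a finite set
`A ⊆ P` such that for all pairwise distinct `a_0, …, a_{2n−1} ∈ P ∖ A` there exists
`c ∈ S` with `a_ℓ R c ↔ ℓ < n` for every `ℓ < 2n`.  Then if `S1` is not `n`-big and
`S2` is not `m`-big, the union `S1 ∪ S2` is not `(n+m)`-big.
-/

namespace Shelah482

/-- `S` is `n`-big for the relation `R`:  some finite `A ⊆ P` witnesses that every
`2n`-tuple of pairwise distinct elements of `P ∖ A` is split by some `c ∈ S` exactly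
into its first `n` and last `n` entries. -/
def NBig {P Q : Type*} (R : P → Q → Prop) (S : Set Q) (n : ℕ) : Prop :=
  ∃ A : Finset P, ∀ a : Fin (2 * n) → P, Function.Injective a → (∀ ℓ, a ℓ ∉ A) →
    ∃ c ∈ S, ∀ ℓ : Fin (2 * n), R (a ℓ) c ↔ (ℓ : ℕ) < n

/-- Interleave a `2n`-tuple with a `2m`-tuple: the two first halves, followed by the two
second halves. -/
def interleaveHalves {P : Type*} {n m : ℕ} (a : Fin (2 * n) → P) (b : Fin (2 * m) → P)
    (k : Fin (2 * (n + m))) : P :=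
  if h₁ : (k : ℕ) < n then a ⟨k, by omega⟩
  else if h₂ : (k : ℕ) < n + m then b ⟨k - n, by omega⟩
  else if h₃ : (k : ℕ) < 2 * n + m then a ⟨k - m, by omega⟩
  else b ⟨k - 2 * n, by omega⟩

section

variable {P : Type*} {n m : ℕ} {a : Fin (2 * n) → P} {b : Fin (2 * m) → P}

theorem interleaveHalves_injective (ha : Function.Injective a) (hb : Function.Injective b)
    (hab : ∀ i j, b j ≠ a i) : Function.Injective (interleaveHalves a b) := by
  intro k l hkl
  unfold interleaveHalves at hkl
  split_ifs at hkl <;>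
    first
    | exact absurd hkl (hab _ _)
    | exact absurd hkl.symm (hab _ _)
    | (have := congrArg Fin.val (ha hkl); ext; dsimp only at this; omega)
    | (have := congrArg Fin.val (hb hkl); ext; dsimp only at this; omega)

theorem interleaveHalves_mem (s : Set P) (ha : ∀ i, a i ∈ s) (hb : ∀ j, b j ∈ s)
    (k : Fin (2 * (n + m))) : interleaveHalves a b k ∈ s := by
  unfold interleaveHalves
  split_ifs <;> first | exact ha _ | exact hb _

theorem exists_interleaveHalves_eq_left (a : Fin (2 * n) → P) (b : Fin (2 * m) → P)
    (i : Fin (2 * n)) :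
    ∃ k, interleaveHalves a b k = a i ∧ ((k : ℕ) < n + m ↔ (i : ℕ) < n) := by
  by_cases hi : (i : ℕ) < n
  · refine ⟨⟨i, by omega⟩, ?_, by simp only; omega⟩
    simp [interleaveHalves, hi]
  · refine ⟨⟨i + m, by omega⟩, ?_, by simp only; omega⟩
    have h₁ : ¬ (i : ℕ) + m < n := by omega
    simp [interleaveHalves, hi, h₁]

theorem exists_interleaveHalves_eq_right (a : Fin (2 * n) → P) (b : Fin (2 * m) → P)
    (j : Fin (2 * m)) :
    ∃ k, interleaveHalves a b k = b j ∧ ((k : ℕ) < n + m ↔ (j : ℕ) < m) := by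
  by_cases hj : (j : ℕ) < m
  · refine ⟨⟨n + j, by omega⟩, ?_, by simp only; omega⟩
    simp [interleaveHalves, hj]
  · refine ⟨⟨2 * n + j, by omega⟩, ?_, by simp only; omega⟩
    have h₁ : ¬ 2 * n + (j : ℕ) < n := by omega
    have h₂ : ¬ 2 * n + (j : ℕ) < n + m := by omega
    simp [interleaveHalves, hj, h₁, h₂]

end

theorem not_nbig_union {P Q : Type*} (R : P → Q → Prop) (S1 S2 : Set Q) (n m : ℕ)
    (h1 : ¬ NBig R S1 n) (h2 : ¬ NBig R S2 m) : ¬ NBig R (S1 ∪ S2) (n + m) := by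
  classical
  rintro ⟨A, hA⟩
  simp only [NBig, not_exists, not_forall] at h1 h2
  obtain ⟨a, ha, haA, hac⟩ := h1 A
  obtain ⟨b, hb, hbA, hbc⟩ := h2 (A ∪ Finset.univ.image a)
  simp only [Finset.mem_union, Finset.mem_image, Finset.mem_univ, true_and, not_or,
    not_exists] at hbA
  obtain ⟨c, hc, hR⟩ := hA (interleaveHalves a b)
    (interleaveHalves_injective ha hb fun i j h => (hbA j).2 i h.symm)
    (interleaveHalves_mem {p | p ∉ A} haA fun j => (hbA j).1)
  rcases hc with hc | hc
  · refine hac c ⟨hc, fun i => ?_⟩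
    obtain ⟨k, hk, hki⟩ := exists_interleaveHalves_eq_left a b i
    rw [← hk, hR k, hki]
  · refine hbc c ⟨hc, fun j => ?_⟩
    obtain ⟨k, hk, hkj⟩ := exists_interleaveHalves_eq_right a b j
    rw [← hk, hR k, hkj]

end Shelah482
end

section
/- Let B1 be an atomic Boolean algebra, B2 a Boolean ring, and f : B1 → B2 a complete embedding. Let d be an atom of B1 and let C ⊆ B1 be a set of elements each lying above d (d ≤ c for all c ∈ C), such that for every atom e ≠ d of B1 there is c ∈ C with e ⊓ c = 0. Then f(d) is the greatest element of {y ∈ B2 : y ≤ f(c) for every c ∈ C}; that is, f(d) ≤ f(c) for every c ∈ C, and every y ∈ B2 with y ≤ f(c) for all c ∈ C satisfies y ≤ f(d). -/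
/-!
Statement 16 (atom-reconstruction step `⊗₁` of Stage E in the Main Lemma 5.2):
if `f : B1 → B2` is a complete embedding of an atomic Boolean algebra `B1` into a
Boolean ring `B2`, `d` is an atom of `B1`, and `C` is a set of elements above `d`
separating `d` from every other atom, then `f d` is the greatest element of
`{y ∈ B2 : y ≤ f c for all c ∈ C}`.
-/

namespace Shelah482

/-- An embedding of Boolean rings (generalized Boolean algebras): an injective map
preserving `⊓`, `⊔`, `\` and `⊥`. -/
structure IsBREmbedding {B1 B2 : Type*} [GeneralizedBooleanAlgebra B1]
    [GeneralizedBooleanAlgebra B2] (f : B1 → B2) : Prop where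
  inj : Function.Injective f
  map_inf : ∀ x y, f (x ⊓ y) = f x ⊓ f y
  map_sup : ∀ x y, f (x ⊔ y) = f x ⊔ f y
  map_sdiff : ∀ x y, f (x \ y) = f x \ f y
  map_bot : f ⊥ = ⊥

/-- A maximal antichain in a Boolean ring: a set of pairwise disjoint nonzero elements
such that every nonzero element has nonzero meet with some member. -/
def IsMaxAntichain {B : Type*} [GeneralizedBooleanAlgebra B] (S : Set B) : Prop :=
  (∀ x ∈ S, x ≠ ⊥) ∧ (∀ x ∈ S, ∀ y ∈ S, x ≠ y → x ⊓ y = ⊥) ∧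
    (∀ b : B, b ≠ ⊥ → ∃ x ∈ S, b ⊓ x ≠ ⊥)

theorem isMaxAntichain_setOf_isAtom {B : Type*} [GeneralizedBooleanAlgebra B] [IsAtomic B] :
    IsMaxAntichain {a : B | IsAtom a} := by
  refine ⟨fun x hx => hx.1, fun x hx y hy hxy => (hx.disjoint_of_ne hy hxy).eq_bot, ?_⟩
  intro b hb
  obtain ⟨a, ha, hab⟩ := (eq_bot_or_exists_atom_le b).resolve_left hb
  exact ⟨a, ha, by simpa [inf_eq_right.2 hab] using ha.1⟩

theorem IsBREmbedding.monotone {B1 B2 : Type*} [GeneralizedBooleanAlgebra B1]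
    [GeneralizedBooleanAlgebra B2] {f : B1 → B2} (hf : IsBREmbedding f) : Monotone f := by
  intro x y hxy
  rw [← inf_eq_left, ← hf.map_inf, inf_eq_left.2 hxy]

theorem completeEmbedding_atom_reconstruction {B1 B2 : Type*} [BooleanAlgebra B1]
    [IsAtomic B1] [GeneralizedBooleanAlgebra B2] (f : B1 → B2)
    (hf : IsBREmbedding f)
    (hcomplete : ∀ S : Set B1, IsMaxAntichain S → IsMaxAntichain (f '' S))
    (d : B1) (hd : IsAtom d) (C : Set B1) (hC : ∀ c ∈ C, d ≤ c)
    (hsep : ∀ e : B1, IsAtom e → e ≠ d → ∃ c ∈ C, e ⊓ c = ⊥) :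
    IsGreatest { y : B2 | ∀ c ∈ C, y ≤ f c } (f d) := by
  refine ⟨fun c hc => hf.monotone (hC c hc), fun y hy => ?_⟩
  rw [← sdiff_eq_bot_iff]
  by_contra hne
  obtain ⟨_, ⟨e, he, rfl⟩, hmeet⟩ := (hcomplete _ isMaxAntichain_setOf_isAtom).2.2 _ hne
  apply hmeet
  by_cases hed : e = d
  · rw [hed]
    exact disjoint_sdiff_self_left.eq_bot
  · obtain ⟨c, hc, hec⟩ := hsep e he hed
    have hdisj : Disjoint (f c) (f e) := by
      rw [disjoint_iff, ← hf.map_inf, inf_comm, hec, hf.map_bot]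
    exact (hdisj.mono_left (sdiff_le.trans (hy c hc))).eq_bot

end Shelah482
end
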